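/- Let V ⊆ ℝⁿ be a finite nonempty set and let w ∈ ℝⁿ have all coordinates nonnegative. Then there exist v ∈ V and w' ∈ ℝⁿ with all coordinates strictly positive such that v minimises ⟨w', ·⟩ over V and ⟨w, v⟩ = min_{u ∈ V} ⟨w, u⟩. (That is, every nonnegative scalarisation of a finite set of cost vectors attains its minimum at a point that is also the minimiser of some strictly positive scalarisation, so the convex coverage set suffices for all scalarising weights.) -/

import Mathlib

open Filter Topology in
/-- A lexicographic minimiser of `(f, g)` over a finite set minimises `f`, and minimises
`f + ε * g` for every sufficiently small `ε > 0`. -/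
theorem Finset.exists_min_image_eventually_add_mul {α : Type*} (s : Finset α) (hs : s.Nonempty)
    (f g : α → ℝ) :
    ∃ v ∈ s, (∀ u ∈ s, f v ≤ f u) ∧
      ∀ᶠ ε in 𝓝[>] (0 : ℝ), ∀ u ∈ s, f v + ε * g v ≤ f u + ε * g u := by
  obtain ⟨v, hv, hmin⟩ := s.exists_min_image (fun u => toLex (f u, g u)) hs
  simp only [Prod.Lex.toLex_le_toLex] at hmin
  refine ⟨v, hv, fun u hu => ?_, (Finset.eventually_all s).2 fun u hu => ?_⟩
  · rcases hmin u hu with h | h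
    exacts [h.le, h.1.le]
  · rcases hmin u hu with h | ⟨hf, hg⟩
    · have hcont (x : α) : Tendsto (fun ε : ℝ => f x + ε * g x) (𝓝[>] 0) (𝓝 (f x)) := by
        have : Continuous fun ε : ℝ => f x + ε * g x := by fun_prop
        simpa using (this.tendsto 0).mono_left nhdsWithin_le_nhds
      exact ((hcont v).eventually_lt (hcont u) h).mono fun _ => le_of_lt
    · filter_upwards [self_mem_nhdsWithin] with ε hε
      exact add_le_add hf.le (mul_le_mul_of_nonneg_left hg (Set.mem_Ioi.1 hε).le)

/-- Every nonnegative scalarisation of a finite nonempty set `V ⊆ ℝⁿ` attains its minimum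
at a point which also minimises some strictly positive scalarisation over `V`. -/
theorem stmt_9 (n : ℕ) (V : Finset (Fin n → ℝ)) (hV : V.Nonempty) (w : Fin n → ℝ)
    (hw : ∀ i, 0 ≤ w i) :
    ∃ v ∈ V, ∃ w' : Fin n → ℝ, (∀ i, 0 < w' i) ∧
      (∀ u ∈ V, ∑ i, w' i * v i ≤ ∑ i, w' i * u i) ∧
      (∀ u ∈ V, ∑ i, w i * v i ≤ ∑ i, w i * u i) := by
  obtain ⟨v, hv, hmin, hε⟩ := V.exists_min_image_eventually_add_mul hV
    (fun u => ∑ i, w i * u i) (fun u => ∑ i, u i)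
  obtain ⟨ε, hε, hpos⟩ := (hε.and self_mem_nhdsWithin).exists
  refine ⟨v, hv, fun i => w i + ε, fun i => add_pos_of_nonneg_of_pos (hw i) hpos, ?_, hmin⟩
  simpa only [add_mul, Finset.sum_add_distrib, Finset.mul_sum] using hε
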